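/- Pointwise consistency of the triangle (greedy) SP algorithm under faithfulness (Corollary 12): Let G* be a DAG on [p] and let C = CI(G*) be exactly the set of d-separation statements of G*. Then C satisfies the TSP assumption with respect to G*; that is, every minimal I-MAP G_π (with respect to C) from which no weakly decreasing sequence of covered arrow reversals reaches a minimal I-MAP with strictly fewer arrows is Markov equivalent to G*. -/

import Mathlib

open scoped Classical

namespace GSP

/-- A DAG on the node set `Fin p`, given by its finite set of arrows,
which must form an acyclic relation. -/
structure DAG (p : ℕ) where
  arrows : Finset (Fin p × Fin p)
  acyclic : ∀ i : Fin p, ¬ Relation.TransGen (fun a b => (a, b) ∈ arrows) i i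

variable {p : ℕ}

namespace DAG

/-- `a → b` is an arrow of `G`. -/
def Arrow (G : DAG p) (a b : Fin p) : Prop := (a, b) ∈ G.arrows

/-- The number of arrows of `G`, denoted `|G|`. -/
def numArrows (G : DAG p) : ℕ := G.arrows.card

/-- The set of parents of a node `j` in `G`. -/
noncomputable def parents (G : DAG p) (j : Fin p) : Finset (Fin p) :=
  Finset.univ.filter fun i => G.Arrow i j

/-- Adjacency: `a` and `b` are joined by an arrow in some direction. -/
def Adj (G : DAG p) (a b : Fin p) : Prop := G.Arrow a b ∨ G.Arrow b a

/-- `b` is a collider between `a` and `c`: both arrows point into `b`. -/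
def Collider (G : DAG p) (a b c : Fin p) : Prop := G.Arrow a b ∧ G.Arrow c b

/-- `d` is a (reflexive) descendant of `a` in `G`. -/
def Desc (G : DAG p) (a d : Fin p) : Prop := Relation.ReflTransGen G.Arrow a d

/-- The list of nodes `l` is a d-connecting walk given `S`: consecutive nodes
are adjacent, every internal collider lies in `S` or has a descendant in `S`,
and no internal non-collider lies in `S`. -/
def DConnWalk (G : DAG p) (S : Finset (Fin p)) (l : List (Fin p)) : Prop :=
  l.Chain' G.Adj ∧
  ∀ (m : ℕ) (_ : 1 ≤ m) (h2 : m + 1 < l.length),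
    (G.Collider (l.get ⟨m - 1, by omega⟩) (l.get ⟨m, by omega⟩) (l.get ⟨m + 1, h2⟩) →
      ∃ d ∈ S, G.Desc (l.get ⟨m, by omega⟩) d) ∧
    (¬ G.Collider (l.get ⟨m - 1, by omega⟩) (l.get ⟨m, by omega⟩) (l.get ⟨m + 1, h2⟩) →
      l.get ⟨m, by omega⟩ ∉ S)

/-- `i` and `j` are d-connected given `S` in `G`. -/
def DConn (G : DAG p) (i j : Fin p) (S : Finset (Fin p)) : Prop :=
  ∃ l : List (Fin p), l.head? = some i ∧ l.getLast? = some j ∧ G.DConnWalk S l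

/-- `i` and `j` are d-separated given `S` in `G`. -/
def DSep (G : DAG p) (i j : Fin p) (S : Finset (Fin p)) : Prop := ¬ G.DConn i j S

end DAG

/-- A conditional independence (CI) relation `i ⊥ j | S` on `[p]`. -/
abbrev CIRel (p : ℕ) := Fin p × Fin p × Finset (Fin p)

/-- The set of CI relations encoded by the d-separations of `G`. -/
def CIof (G : DAG p) : Set (CIRel p) :=
  {t | t.1 ≠ t.2.1 ∧ t.1 ∉ t.2.2 ∧ t.2.1 ∉ t.2.2 ∧ G.DSep t.1 t.2.1 t.2.2}

/-- The symmetric closure of a set of CI relations. -/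
def symClosure (C : Set (CIRel p)) : Set (CIRel p) :=
  {t | t ∈ C ∨ (t.2.1, t.1, t.2.2) ∈ C}

/-- Symmetry of a set of CI relations. -/
def SymmetricCI (C : Set (CIRel p)) : Prop :=
  ∀ i j S, (i, j, S) ∈ C → (j, i, S) ∈ C

/-- A semigraphoid: symmetric and satisfying (SG2). -/
def Semigraphoid (C : Set (CIRel p)) : Prop :=
  SymmetricCI C ∧
  ∀ i j k S, (i, j, S) ∈ C → (i, k, insert j S) ∈ C →
    (i, k, S) ∈ C ∧ (i, j, insert k S) ∈ C

/-- A graphoid: a semigraphoid additionally satisfying intersection (INT). -/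
def Graphoid (C : Set (CIRel p)) : Prop :=
  Semigraphoid C ∧
  ∀ i j k S, (i, j, insert k S) ∈ C → (i, k, insert j S) ∈ C →
    (i, j, S) ∈ C ∧ (i, k, S) ∈ C

/-- Build a DAG from a relation compatible with a numeric ordering. -/
noncomputable def mkDAG (R : Fin p → Fin p → Prop) (f : Fin p → ℕ)
    (hf : ∀ a b, R a b → f a < f b) : DAG p where
  arrows := Finset.univ.filter fun e : Fin p × Fin p => R e.1 e.2
  acyclic := by
    intro i hi
    have key : ∀ a b : Fin p,
        Relation.TransGen (fun a b : Fin p =>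
          (a, b) ∈ Finset.univ.filter fun e : Fin p × Fin p => R e.1 e.2) a b →
        f a < f b := by
      intro a b h
      induction h with
      | single h => exact hf _ _ (by simpa using h)
      | tail _ h ih => exact lt_trans ih (hf _ _ (by simpa using h))
    exact lt_irrefl _ (key i i hi)

/-- The conditioning set `{π_1, …, π_j} \ {π_i, π_j}` (where `b = π_j` is the
later node and `a = π_i` the earlier one) used in the definition of minimal
I-MAPs. -/
noncomputable def condSet (π : Equiv.Perm (Fin p)) (a b : Fin p) : Finset (Fin p) :=
  ((Finset.univ.filter fun k : Fin p => π.symm k ≤ π.symm b).erase a).erase b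

/-- The minimal I-MAP `G_π` of a set `C` of CI relations with respect to the
permutation (ordering) `π`: there is an arrow `π_i → π_j` for positions `i < j`
iff `π_i ⊥ π_j | {π_1, …, π_j} \ {π_i, π_j}` is not in `C`. -/
noncomputable def minimalIMAP (C : Set (CIRel p)) (π : Equiv.Perm (Fin p)) : DAG p :=
  mkDAG (fun a b => π.symm a < π.symm b ∧ (a, b, condSet π a b) ∉ C)
    (fun a => (π.symm a : ℕ)) (fun a b h => by exact_mod_cast h.1)

/-- Markov equivalence of DAGs: equal sets of d-separation statements. -/
def MarkovEquiv (G H : DAG p) : Prop := CIof G = CIof H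

/-- `H` is an independence map of `G`, written `G ≤ H`: `CI(H) ⊆ CI(G)`. -/
def IMapLE (G H : DAG p) : Prop := CIof H ⊆ CIof G

/-- `π` is a linear extension of `G`: every arrow goes from an earlier to a
later element of `π`. -/
def IsLinExt (G : DAG p) (π : Equiv.Perm (Fin p)) : Prop :=
  ∀ a b, G.Arrow a b → π.symm a < π.symm b

/-- `a → b` is a covered arrow of `G`: `pa(a) = pa(b) \ {a}`. -/
def DAG.Covered (G : DAG p) (a b : Fin p) : Prop :=
  G.Arrow a b ∧ G.parents a = (G.parents b).erase a

/-- The minimal I-MAPs `G_σ` and `G_ρ` are connected by a covered arrow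
reversal: `ρ` is a linear extension of the DAG obtained from `G_σ` by
reversing one covered arrow of `G_σ`. -/
def CoveredReversalStep (C : Set (CIRel p)) (σ ρ : Equiv.Perm (Fin p)) : Prop :=
  ∃ a b : Fin p, (minimalIMAP C σ).Covered a b ∧
    ρ.symm b < ρ.symm a ∧
    ∀ x y : Fin p, (minimalIMAP C σ).Arrow x y → (x, y) ≠ (a, b) →
      ρ.symm x < ρ.symm y

/-- A weakly decreasing sequence of covered arrow reversals: a sequence of
minimal I-MAPs in which consecutive members are connected by covered arrow
reversals and the number of arrows never increases. -/
def WeaklyDecreasingSeq (C : Set (CIRel p)) (s : List (Equiv.Perm (Fin p))) : Prop :=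
  s.Chain' fun σ ρ => CoveredReversalStep C σ ρ ∧
    (minimalIMAP C ρ).numArrows ≤ (minimalIMAP C σ).numArrows

/-- Some weakly decreasing sequence of covered arrow reversals starting at
`G_π` reaches a minimal I-MAP with strictly fewer arrows. -/
def EscapesByCoveredReversals (C : Set (CIRel p)) (π : Equiv.Perm (Fin p)) : Prop :=
  ∃ (s : List (Equiv.Perm (Fin p))) (τ : Equiv.Perm (Fin p)),
    s.head? = some π ∧ s.getLast? = some τ ∧ WeaklyDecreasingSeq C s ∧
    (minimalIMAP C τ).numArrows < (minimalIMAP C π).numArrows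

/-- The TSP assumption of `C` with respect to `G`. -/
def TSP (C : Set (CIRel p)) (G : DAG p) : Prop :=
  CIof G ⊆ C ∧
  ∀ π : Equiv.Perm (Fin p), ¬ EscapesByCoveredReversals C π →
    MarkovEquiv (minimalIMAP C π) G

/-- The SMR assumption of `C` with respect to `G`. -/
def SMR (C : Set (CIRel p)) (G : DAG p) : Prop :=
  CIof G ⊆ C ∧
  ∀ H : DAG p, CIof H ⊆ C → ¬ MarkovEquiv H G → G.numArrows < H.numArrows

end GSP

namespace GSP

variable {p : ℕ}

theorem DAG.Arrow.asymm {G : DAG p} {a b : Fin p} (h : G.Arrow a b) : ¬ G.Arrow b a :=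
  fun h' => G.acyclic a (.tail (.single h) h')

theorem DAG.Arrow.ne {G : DAG p} {a b : Fin p} (h : G.Arrow a b) : a ≠ b := by
  rintro rfl
  exact h.asymm h

theorem DAG.ext_arrow {G H : DAG p} (h : ∀ a b, G.Arrow a b ↔ H.Arrow a b) : G = H := by
  cases G
  cases H
  congr 1
  ext ⟨a, b⟩
  exact h a b

/-- `A` and `B` are disjoint from each other and from `S`, the set `A ∪ B ∪ S` is ancestral, and
no family (a node together with its parents) of this set meets both `A` and `B`. In other words,
`S` separates `A` from `B` in the moral graph of the ancestral set `A ∪ B ∪ S`. -/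
structure DAG.Split (G : DAG p) (A B S : Finset (Fin p)) : Prop where
  disjoint : ∀ x, x ∈ A → x ∉ B
  left : ∀ x, x ∈ A → x ∉ S
  right : ∀ x, x ∈ B → x ∉ S
  family : ∀ v, v ∈ A ∨ v ∈ B ∨ v ∈ S →
    (∀ x, x = v ∨ G.Arrow x v → x ∈ A ∨ x ∈ S) ∨ (∀ x, x = v ∨ G.Arrow x v → x ∈ B ∨ x ∈ S)

/-- `A` and `B` extend to a `Split` given `S`. -/
def DAG.Sep (G : DAG p) (A B S : Finset (Fin p)) : Prop :=
  ∃ A' B', A ⊆ A' ∧ B ⊆ B' ∧ G.Split A' B' S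

theorem DAG.Split.symm {G : DAG p} {A B S : Finset (Fin p)} (h : G.Split A B S) :
    G.Split B A S where
  disjoint x hx hx' := h.disjoint x hx' hx
  left := h.right
  right := h.left
  family v hv := (h.family v (by tauto)).symm

theorem DAG.Sep.symm {G : DAG p} {A B S : Finset (Fin p)} : G.Sep A B S → G.Sep B A S :=
  fun ⟨A', B', hA, hB, h⟩ => ⟨B', A', hB, hA, h.symm⟩

theorem DAG.dConnWalk_pair {G : DAG p} {S : Finset (Fin p)} {x y : Fin p} :
    G.DConnWalk S [x, y] ↔ G.Adj x y := by
  constructor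
  · rintro ⟨h, -⟩
    exact List.isChain_pair.1 h
  · intro h
    refine ⟨List.isChain_pair.2 h, fun m h1 h2 => ?_⟩
    simp at h2
    omega

theorem DAG.dConnWalk_cons {G : DAG p} {S : Finset (Fin p)} {x y z : Fin p} {l : List (Fin p)} :
    G.DConnWalk S (x :: y :: z :: l) ↔
      G.Adj x y ∧ (G.Collider x y z → ∃ d ∈ S, G.Desc y d) ∧ (¬ G.Collider x y z → y ∉ S) ∧
        G.DConnWalk S (y :: z :: l) := by
  constructor
  · rintro ⟨h, h'⟩
    have h1 := h' 1 le_rfl (by simp)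
    have hc := List.isChain_cons_cons.1 h
    refine ⟨hc.1, h1.1, h1.2, hc.2, fun m hm hm2 => ?_⟩
    have h2 := h' (m + 1) (by omega) (by simpa using hm2)
    obtain ⟨k, rfl⟩ : ∃ k, m = k + 1 := ⟨m - 1, by omega⟩
    exact h2
  · rintro ⟨hxy, hc, hn, h, h'⟩
    refine ⟨List.isChain_cons_cons.2 ⟨hxy, h⟩, fun m hm hm2 => ?_⟩
    obtain rfl | hm1 := Nat.eq_or_lt_of_le hm
    · exact ⟨hc, hn⟩
    · obtain ⟨k, rfl⟩ : ∃ k, m = k + 2 := ⟨m - 2, by omega⟩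
      exact h' (k + 1) (by omega) (by simpa using hm2)

theorem DAG.Split.mem_of_arrow {G : DAG p} {A B S : Finset (Fin p)} (h : G.Split A B S)
    {x v : Fin p} (hx : G.Arrow x v) (hv : v ∈ A ∨ v ∈ B ∨ v ∈ S) : x ∈ A ∨ x ∈ B ∨ x ∈ S := by
  rcases h.family v hv with h | h <;> have := h x (.inr hx) <;> tauto

theorem DAG.Split.mem_of_desc {G : DAG p} {A B S : Finset (Fin p)} (h : G.Split A B S)
    {x v : Fin p} (hx : G.Desc x v) (hv : v ∈ A ∨ v ∈ B ∨ v ∈ S) : x ∈ A ∨ x ∈ B ∨ x ∈ S := by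
  induction hx using Relation.ReflTransGen.head_induction_on with
  | refl => exact hv
  | head h1 _ ih => exact h.mem_of_arrow h1 ih

theorem DAG.Split.mem_of_walk {G : DAG p} {A B S : Finset (Fin p)} (h : G.Split A B S)
    {j : Fin p} (hj : j ∈ B) (l : List (Fin p)) : ∀ x y : Fin p,
    (y :: l).getLast? = some j → G.DConnWalk S (x :: y :: l) → G.Arrow x y →
    y ∈ A ∨ y ∈ B ∨ y ∈ S := by
  induction l with
  | nil =>
    intro x y hl _ _
    simp at hl
    simp [hl, hj]
  | cons z l ih =>
    intro x y hl hw hxy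
    rw [DAG.dConnWalk_cons] at hw
    by_cases hz : G.Arrow z y
    · obtain ⟨d, hd, hyd⟩ := hw.2.1 ⟨hxy, hz⟩
      exact h.mem_of_desc hyd (by tauto)
    · have hadj : G.Adj y z := by
        cases l with
        | nil => exact DAG.dConnWalk_pair.1 hw.2.2.2
        | cons w l => exact (DAG.dConnWalk_cons.1 hw.2.2.2).1
      have hyz : G.Arrow y z := hadj.resolve_right hz
      exact h.mem_of_arrow hyz (ih y z (by simpa using hl) hw.2.2.2 hyz)

theorem DAG.Split.not_walk {G : DAG p} {A B S : Finset (Fin p)} (h : G.Split A B S)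
    {j : Fin p} (hj : j ∈ B) (n : ℕ) : ∀ (l : List (Fin p)) (x : Fin p), l.length ≤ n → x ∈ A →
    (x :: l).getLast? = some j → ¬ G.DConnWalk S (x :: l) := by
  induction n with
  | zero =>
    intro l x hl hx hlast _
    obtain rfl : l = [] := by simpa using hl
    simp at hlast
    exact h.disjoint x hx (hlast ▸ hj)
  | succ n ih =>
    intro l x hl hx hlast hw
    rcases l with _ | ⟨y, l⟩
    · exact ih [] x (by simp) hx hlast hw
    have hadj : G.Adj x y := by
      cases l with
      | nil => exact DAG.dConnWalk_pair.1 hw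
      | cons w l => exact (DAG.dConnWalk_cons.1 hw).1
    have hyU : y ∈ A ∨ y ∈ B ∨ y ∈ S := by
      rcases hadj with hxy | hyx
      · exact h.mem_of_walk hj l x y (by simpa using hlast) hw hxy
      · exact h.mem_of_arrow hyx (.inl hx)
    have hyB : y ∉ B := by
      intro hyB
      have h1 := h.disjoint x hx
      have h2 := h.left x hx
      have h3 := h.right y hyB
      have h4 := fun hA => h.disjoint y hA hyB
      rcases hadj with hxy | hyx
      · rcases h.family y (by tauto) with hf | hf
        · have := hf y (.inl rfl); tauto
        · have := hf x (.inr hxy); tauto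
      · rcases h.family x (by tauto) with hf | hf
        · have := hf y (.inr hyx); tauto
        · have := hf x (.inl rfl); tauto
    rcases l with _ | ⟨z, l⟩
    · simp at hlast
      exact hyB (hlast ▸ hj)
    have hw' := DAG.dConnWalk_cons.1 hw
    by_cases hyA : y ∈ A
    · exact ih (z :: l) y (by simpa using hl) hyA (by simpa using hlast) hw'.2.2.2
    have hyS : y ∈ S := by tauto
    by_cases hcol : G.Collider x y z
    swap
    · exact hw'.2.2.1 hcol hyS
    have hzA : z ∈ A ∨ z ∈ S := by
      rcases h.family y (by tauto) with hf | hf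
      · exact hf z (.inr hcol.2)
      · have h1 := h.disjoint x hx
        have h2 := h.left x hx
        have := hf x (.inr hcol.1); tauto
    have hzS : z ∉ S := by
      rcases l with _ | ⟨w, l⟩
      · simp at hlast
        exact hlast ▸ h.right j hj
      · exact (DAG.dConnWalk_cons.1 hw'.2.2.2).2.2.1 fun hc => hc.1.asymm hcol.2
    refine ih l z (by simp at hl; omega) (by tauto) (by simpa using hlast) ?_
    rcases l with _ | ⟨w, l⟩
    · exact ⟨.singleton _, fun m h1 h2 => by simp at h2⟩
    · exact (DAG.dConnWalk_cons.1 hw'.2.2.2).2.2.2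

theorem DAG.Split.dSep {G : DAG p} {A B S : Finset (Fin p)} (h : G.Split A B S)
    {i j : Fin p} (hi : i ∈ A) (hj : j ∈ B) : G.DSep i j S := by
  rintro ⟨l, h1, h2, h3⟩
  rcases l with _ | ⟨x, l⟩
  · simp at h1
  · simp at h1
    subst h1
    exact h.not_walk hj l.length l x le_rfl hi h2 h3

/-- The ends `x` of d-connecting walks given `S` that start in `A`. The flag records whether the
last arrow of the walk points into `x`. -/
inductive DAG.Reach (G : DAG p) (S A : Finset (Fin p)) : Fin p → Bool → Prop
  | start {a : Fin p} : a ∈ A → DAG.Reach G S A a false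
  | down {x y : Fin p} {d : Bool} :
    DAG.Reach G S A x d → x ∉ S → G.Arrow x y → DAG.Reach G S A y true
  | up {x y : Fin p} : DAG.Reach G S A x false → x ∉ S → G.Arrow y x → DAG.Reach G S A y false
  | collider {x y : Fin p} : DAG.Reach G S A x true → (∃ d ∈ S, G.Desc x d) → G.Arrow y x →
    DAG.Reach G S A y false

theorem DAG.DConnWalk.cons {G : DAG p} {S : Finset (Fin p)} {x y : Fin p} {t : List (Fin p)}
    (h : G.DConnWalk S (y :: t)) (hxy : G.Adj x y)
    (hc : ∀ z t', t = z :: t' → (G.Collider x y z → ∃ d ∈ S, G.Desc y d) ∧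
      (¬ G.Collider x y z → y ∉ S)) :
    G.DConnWalk S (x :: y :: t) := by
  rcases t with _ | ⟨z, t⟩
  · exact DAG.dConnWalk_pair.2 hxy
  · exact DAG.dConnWalk_cons.2 ⟨hxy, (hc z t rfl).1, (hc z t rfl).2, h⟩

theorem DAG.Reach.exists_walk {G : DAG p} {S A : Finset (Fin p)} {x : Fin p} {d : Bool}
    (h : G.Reach S A x d) : ∃ t : List (Fin p), ∃ a ∈ A, (x :: t).getLast? = some a ∧
      G.DConnWalk S (x :: t) ∧
      ∀ z t', t = z :: t' → (d = false → G.Arrow x z) ∧ (d = true → G.Arrow z x) := by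
  induction h with
  | @start a ha =>
    exact ⟨[], a, ha, by simp, ⟨.singleton _, fun m h1 h2 => by simp at h2⟩, by simp⟩
  | @down x y d _ hx hxy ih =>
    obtain ⟨t, a, ha, hl, hw, hd⟩ := ih
    refine ⟨x :: t, a, ha, by simpa using hl, hw.cons (.inr hxy) fun z t' _ =>
      ⟨fun hc => absurd hc.1 hxy.asymm, fun _ => hx⟩, ?_⟩
    rintro z t' ⟨⟩
    simpa using hxy
  | @up x y _ hx hyx ih =>
    obtain ⟨t, a, ha, hl, hw, hd⟩ := ih
    refine ⟨x :: t, a, ha, by simpa using hl, hw.cons (.inl hyx) fun z t' ht =>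
      ⟨fun hc => absurd hc.2 ((hd z t' ht).1 rfl).asymm, fun _ => hx⟩, ?_⟩
    rintro z t' ⟨⟩
    simpa using hyx
  | @collider x y _ hx hyx ih =>
    obtain ⟨t, a, ha, hl, hw, hd⟩ := ih
    refine ⟨x :: t, a, ha, by simpa using hl, hw.cons (.inl hyx) fun z t' ht =>
      ⟨fun _ => hx, fun hc => absurd ⟨hyx, (hd z t' ht).2 rfl⟩ hc⟩, ?_⟩
    rintro z t' ⟨⟩
    simpa using hyx

theorem DAG.Reach.desc {G : DAG p} {S A : Finset (Fin p)} {x y : Fin p} (hxy : G.Desc x y)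
    {d : Bool} (h : G.Reach S A x d) (hx : ∀ s ∈ S, ¬ G.Desc x s) : ∃ d, G.Reach S A y d := by
  induction hxy with
  | refl => exact ⟨d, h⟩
  | @tail b c hb hbc ih =>
    obtain ⟨d, hd⟩ := ih
    exact ⟨true, hd.down (fun hbS => hx b hbS hb) hbc⟩

theorem DAG.Reach.of_desc_mem {G : DAG p} {S A : Finset (Fin p)} {x a : Fin p} (hxa : G.Desc x a)
    (ha : a ∈ A) (hx : ∀ s ∈ S, ¬ G.Desc x s) : G.Reach S A x false := by
  induction hxa using Relation.ReflTransGen.head_induction_on with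
  | refl => exact .start ha
  | @head b c hbc _ ih =>
    have hc : ∀ s ∈ S, ¬ G.Desc c s := fun s hs h => hx s hs (.head hbc h)
    exact (ih hc).up (fun hcS => hc c hcS .refl) hbc

theorem DAG.sep_of_not_reach {G : DAG p} {A B S : Finset (Fin p)} (hA : ∀ a ∈ A, a ∉ S)
    (hB : ∀ b ∈ B, b ∉ S) (h : ∀ b ∈ B, ∀ d, ¬ G.Reach S A b d) : G.Sep A B S := by
  let U : Finset (Fin p) := Finset.univ.filter fun u => ∃ w ∈ A ∪ B ∪ S, G.Desc u w
  let A' := U.filter fun u => u ∉ S ∧ ∃ d, G.Reach S A u d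
  let B' := U.filter fun u => u ∉ S ∧ ¬ ∃ d, G.Reach S A u d
  have hU : ∀ u, u ∈ U ↔ ∃ w ∈ A ∪ B ∪ S, G.Desc u w := by simp [U]
  have hA' : ∀ u, u ∈ A' ↔ u ∈ U ∧ u ∉ S ∧ ∃ d, G.Reach S A u d := by simp [A']
  have hB' : ∀ u, u ∈ B' ↔ u ∈ U ∧ u ∉ S ∧ ¬ ∃ d, G.Reach S A u d := by simp [B']
  have hself : ∀ u, u ∈ A ∪ B ∪ S → u ∈ U := fun u hu => (hU u).2 ⟨u, hu, .refl⟩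
  have hanc : ∀ u v, G.Arrow u v → v ∈ U → u ∈ U := by
    intro u v huv hv
    obtain ⟨w, hw, hvw⟩ := (hU v).1 hv
    exact (hU u).2 ⟨w, hw, .head huv hvw⟩
  -- descendants in `A ∪ B` when there are none in `S`
  have hkey : ∀ v ∈ U, (∀ s ∈ S, ¬ G.Desc v s) → ∀ d, G.Reach S A v d → G.Reach S A v false := by
    intro v hv hS d hd
    obtain ⟨w, hw, hvw⟩ := (hU v).1 hv
    simp only [Finset.mem_union] at hw
    rcases hw with (hw | hw) | hw
    · exact .of_desc_mem hvw hw hS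
    · obtain ⟨d', hd'⟩ := hd.desc hvw hS
      exact absurd hd' (h w hw d')
    · exact absurd hvw (hS w hw)
  have hpar : ∀ v ∈ U, ∀ d, G.Reach S A v d → (v ∈ S → d = true) → ∀ y, G.Arrow y v →
      G.Reach S A y false := by
    intro v hv d hd hvd y hy
    by_cases hS : ∃ s ∈ S, G.Desc v s
    · rcases d with _ | _
      · exact hd.up (fun hvS => by simpa using hvd hvS) hy
      · exact hd.collider hS hy
    · push Not at hS
      exact (hkey v hv hS d hd).up (fun hvS => hS v hvS .refl) hy
  refine ⟨A', B', fun a ha => ?_, fun b hb => ?_, ?_, ?_, ?_, ?_⟩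
  · exact (hA' a).2 ⟨hself a (by simp [ha]), hA a ha, false, .start ha⟩
  · exact (hB' b).2 ⟨hself b (by simp [hb]), hB b hb, fun ⟨d, hd⟩ => h b hb d hd⟩
  · intro x hx hx'
    exact ((hB' x).1 hx').2.2 ((hA' x).1 hx).2.2
  · intro x hx
    exact ((hA' x).1 hx).2.1
  · intro x hx
    exact ((hB' x).1 hx).2.1
  · intro v hv
    have hvU : v ∈ U := by
      rcases hv with hv | hv | hv
      · exact ((hA' v).1 hv).1
      · exact ((hB' v).1 hv).1
      · exact hself v (by simp [hv])
    have hfU : ∀ x, x = v ∨ G.Arrow x v → x ∈ U := by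
      rintro x (rfl | hx)
      · exact hvU
      · exact hanc x v hx hvU
    by_cases hex : ∃ x, (x = v ∨ G.Arrow x v) ∧ x ∈ A'
    · left
      obtain ⟨x, hx, hxA⟩ := hex
      obtain ⟨-, hxS, d, hd⟩ := (hA' x).1 hxA
      -- `v` is reached, by an arrow into `v` if `v ∈ S`
      obtain ⟨d', hv', hd'⟩ : ∃ d', G.Reach S A v d' ∧ (v ∈ S → d' = true) := by
        rcases hx with rfl | hx
        · exact ⟨d, hd, fun h => absurd h hxS⟩
        · exact ⟨true, hd.down hxS hx, fun _ => rfl⟩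
      intro y hy
      by_cases hyS : y ∈ S
      · exact .inr hyS
      refine .inl ((hA' y).2 ⟨hfU y hy, hyS, ?_⟩)
      rcases hy with rfl | hy
      · exact ⟨d', hv'⟩
      · exact ⟨false, hpar v hvU d' hv' hd' y hy⟩
    · right
      push Not at hex
      intro y hy
      by_cases hyS : y ∈ S
      · exact .inr hyS
      refine .inl ((hB' y).2 ⟨hfU y hy, hyS, fun hr => hex y hy ((hA' y).2 ⟨hfU y hy, hyS, hr⟩)⟩)

theorem DAG.Sep.not_reach {G : DAG p} {A B S : Finset (Fin p)} (h : G.Sep A B S) {b : Fin p}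
    (hb : b ∈ B) (d : Bool) : ¬ G.Reach S A b d := by
  intro hr
  obtain ⟨A', B', hA, hB, hs⟩ := h
  obtain ⟨t, a, ha, hl, hw, -⟩ := hr.exists_walk
  exact hs.symm.dSep (hB hb) (hA ha) ⟨b :: t, rfl, hl, hw⟩

theorem DAG.Sep.left {G : DAG p} {A B S : Finset (Fin p)} (h : G.Sep A B S) :
    ∀ a ∈ A, a ∉ S := by
  obtain ⟨A', B', hA, hB, hs⟩ := h
  exact fun a ha => hs.left a (hA ha)

theorem DAG.sep_iff {G : DAG p} {A B S : Finset (Fin p)} :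
    G.Sep A B S ↔ (∀ a ∈ A, a ∉ S) ∧ (∀ b ∈ B, b ∉ S) ∧ ∀ b ∈ B, ∀ d, ¬ G.Reach S A b d :=
  ⟨fun h => ⟨h.left, h.symm.left, fun _ hb => h.not_reach hb⟩,
    fun h => DAG.sep_of_not_reach h.1 h.2.1 h.2.2⟩

theorem mem_CIof_iff {G : DAG p} {i j : Fin p} {S : Finset (Fin p)} :
    (i, j, S) ∈ CIof G ↔ G.Sep {i} {j} S := by
  constructor
  · rintro ⟨hij, hi, hj, hs⟩
    refine DAG.Sep.symm (DAG.sep_of_not_reach (by simpa using hj) (by simpa using hi) ?_)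
    intro b hb d hr
    obtain ⟨t, a, ha, hl, hw, -⟩ := hr.exists_walk
    simp only [Finset.mem_singleton] at ha hb
    subst ha hb
    exact hs ⟨b :: t, rfl, hl, hw⟩
  · rintro ⟨A, B, hA, hB, hs⟩
    simp only [Finset.singleton_subset_iff] at hA hB
    exact ⟨fun h : i = j => hs.disjoint i hA (h ▸ hB), hs.left i hA, hs.right j hB, hs.dSep hA hB⟩

theorem DAG.Sep.mono {G : DAG p} {A B A' B' S : Finset (Fin p)} (h : G.Sep A B S) (hA : A' ⊆ A)
    (hB : B' ⊆ B) : G.Sep A' B' S := by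
  obtain ⟨A₁, B₁, h1, h2, hs⟩ := h
  exact ⟨A₁, B₁, hA.trans h1, hB.trans h2, hs⟩

/-- Composition. -/
theorem DAG.sep_of_forall {G : DAG p} {a : Fin p} {B S : Finset (Fin p)} (ha : a ∉ S)
    (h : ∀ b ∈ B, (b, a, S) ∈ CIof G) : G.Sep {a} B S := by
  rw [DAG.sep_iff]
  have h' : ∀ b ∈ B, G.Sep {a} {b} S := fun b hb => (mem_CIof_iff.1 (h b hb)).symm
  exact ⟨by simpa using ha, fun b hb => (h' b hb).symm.left b (by simp),
    fun b hb d => (h' b hb).not_reach (by simp) d⟩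

theorem DAG.Sep.weak_union {G : DAG p} {A B C S : Finset (Fin p)} (h : G.Sep A B S) (hC : C ⊆ B) :
    G.Sep A (B \ C) (S ∪ C) := by
  obtain ⟨A₁, B₁, h1, h2, hs⟩ := h
  refine ⟨A₁, B₁ \ C, h1, Finset.sdiff_subset_sdiff h2 subset_rfl, ?_, ?_, ?_, ?_⟩
  · intro x hx
    have := hs.disjoint x hx
    grind
  · intro x hx
    have := hs.disjoint x hx
    have := hs.left x hx
    grind
  · intro x hx
    have := hs.right x
    grind
  · intro v hv
    rcases hs.family v (by grind) with hf | hf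
    · left
      intro x hx
      have := hf x hx
      grind
    · right
      intro x hx
      have := hf x hx
      grind

theorem DAG.Reach.union {G : DAG p} {A B S : Finset (Fin p)} {x : Fin p} {d : Bool}
    (h : G.Reach S A x d) : G.Reach (S ∪ B) A x d ∨ ∃ b ∈ B, ∃ d, G.Reach S A b d := by
  induction h with
  | start ha => exact .inl (.start ha)
  | @down x y d hr hx hxy ih =>
    by_cases hxB : x ∈ B
    · exact .inr ⟨x, hxB, d, hr⟩
    · exact ih.imp_left fun h => h.down (by simp [hx, hxB]) hxy
  | @up x y hr hx hxy ih =>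
    by_cases hxB : x ∈ B
    · exact .inr ⟨x, hxB, false, hr⟩
    · exact ih.imp_left fun h => h.up (by simp [hx, hxB]) hxy
  | @collider x y hr hx hxy ih =>
    obtain ⟨s, hs, hxs⟩ := hx
    exact ih.imp_left fun h => h.collider ⟨s, by simp [hs], hxs⟩ hxy

theorem DAG.Sep.contraction {G : DAG p} {A B C S : Finset (Fin p)} (h : G.Sep A B S)
    (h' : G.Sep A C (S ∪ B)) : G.Sep A (B ∪ C) S := by
  rw [DAG.sep_iff] at *
  have key : ∀ b ∈ B, ¬ ∃ d, G.Reach S A b d := fun b hb ⟨d, hd⟩ => h.2.2 b hb d hd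
  refine ⟨h.1, fun b hb => ?_, fun b hb d hr => ?_⟩
  · have := h.2.1 b
    have := h'.2.1 b
    grind
  · rcases Finset.mem_union.1 hb with hb | hb
    · exact h.2.2 b hb d hr
    · rcases hr.union (B := B) with hr | ⟨b', hb', hr⟩
      · exact h'.2.2 b hb d hr
      · exact key b' hb' hr

/-- Intersection, for a node all of whose pairwise separations from `N` hold. -/
theorem DAG.sep_of_pairwise {G : DAG p} {v : Fin p} {P N : Finset (Fin p)} (hv : v ∉ P)
    (h : ∀ n ∈ N, (n, v, P.erase n) ∈ CIof G) : G.Sep {v} N (P \ N) := by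
  have key : ∀ {x d}, G.Reach (P \ N) {v} x d →
      (∃ n ∈ N, ∃ d, G.Reach (P.erase n) {v} n d) ∨ ∀ n ∈ N, G.Reach (P.erase n) {v} x d := by
    intro x d hr
    induction hr with
    | start ha => exact .inr fun n _ => .start ha
    | @down x y d hr hx hxy ih =>
      refine ih.elim .inl fun ih => ?_
      by_cases hxN : x ∈ N
      · exact .inl ⟨x, hxN, d, ih x hxN⟩
      · exact .inr fun n hn => (ih n hn).down (by grind) hxy
    | @up x y hr hx hxy ih =>
      refine ih.elim .inl fun ih => ?_
      by_cases hxN : x ∈ N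
      · exact .inl ⟨x, hxN, false, ih x hxN⟩
      · exact .inr fun n hn => (ih n hn).up (by grind) hxy
    | @collider x y hr hx hxy ih =>
      obtain ⟨s, hs, hxs⟩ := hx
      exact ih.imp_right fun h n hn => (h n hn).collider ⟨s, by grind, hxs⟩ hxy
  have h' : ∀ n ∈ N, ∀ d, ¬ G.Reach (P.erase n) {v} n d := fun n hn d =>
    (mem_CIof_iff.1 (h n hn)).symm.not_reach (by simp) d
  rw [DAG.sep_iff]
  refine ⟨by grind, fun b hb => by simp [hb], fun b hb d hr => ?_⟩
  rcases key hr with ⟨n, hn, d', hr'⟩ | hr'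
  · exact h' n hn d' hr'
  · exact h' b hb d (hr' b hb)

theorem CIof_subset_of_split {G H : DAG p} (h : ∀ A B S, H.Split A B S → G.Sep A B S) :
    CIof H ⊆ CIof G := by
  rintro ⟨i, j, S⟩ hij
  obtain ⟨A, B, hA, hB, hs⟩ := mem_CIof_iff.1 hij
  exact mem_CIof_iff.2 ((h A B S hs).mono hA hB)

theorem DAG.mem_parents {G : DAG p} {a v : Fin p} : a ∈ G.parents v ↔ G.Arrow a v := by
  simp [DAG.parents]

/-- A DAG whose ordered local Markov property holds in `G` is an independence map of `G`. -/
theorem CIof_subset_of_local {G H : DAG p} {f : Fin p → ℕ} (hf : f.Injective)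
    (hH : ∀ a b, H.Arrow a b → f a < f b)
    (hloc : ∀ a v, f a < f v → ¬ H.Arrow a v → (a, v, H.parents v) ∈ CIof G) :
    CIof H ⊆ CIof G := by
  refine CIof_subset_of_split fun A B S hs => ?_
  induction hn : (A ∪ B ∪ S).card generalizing A B S with
  | zero =>
    have h0 := Finset.card_eq_zero.1 hn
    refine ⟨A, B, subset_rfl, subset_rfl, hs.disjoint, hs.left, hs.right, fun v hv => ?_⟩
    have : v ∈ A ∪ B ∪ S := by simpa [or_assoc] using hv
    simp [h0] at this
  | succ n ih =>
    obtain ⟨v, hv, hmax⟩ := Finset.exists_max_image (A ∪ B ∪ S) f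
      (Finset.card_pos.1 (by omega))
    -- it suffices to treat the case where the family of `v` avoids `B`
    wlog hfam : ∀ x, x = v ∨ H.Arrow x v → x ∈ A ∨ x ∈ S generalizing A B
    · refine (this B A hs.symm ?_ ?_ ?_ ?_).symm
      · rwa [Finset.union_comm B A]
      · rwa [Finset.union_comm B A]
      · rwa [Finset.union_comm B A]
      · exact (hs.family v (by simpa [or_assoc] using hv)).resolve_left hfam
    have hvB : v ∉ B := fun h => (hfam v (.inl rfl)).elim (fun h' => hs.disjoint v h' h)
      (hs.right v h)
    have hout : ∀ u, u ∈ A ∪ B ∪ S → ¬ H.Arrow v u := fun u hu h =>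
      (hH v u h).not_ge (hmax u hu)
    have hs' : H.Split (A.erase v) B (S.erase v) := by
      refine ⟨fun x hx => hs.disjoint x (by grind), fun x hx => ?_, fun x hx => ?_, fun u hu => ?_⟩
      · have := hs.left x
        grind
      · have := hs.right x
        grind
      · have hne : ∀ x, x = u ∨ H.Arrow x u → x ≠ v := by
          rintro x (rfl | hx) rfl
          · grind
          · exact hout u (by grind) hx
        refine (hs.family u (by grind)).imp (fun h x hx => ?_) fun h x hx => ?_
        all_goals
          have := h x hx
          have := hne x hx
          grind
    have hn' : (A.erase v ∪ B ∪ S.erase v).card = n := by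
      have : A.erase v ∪ B ∪ S.erase v = (A ∪ B ∪ S).erase v := by grind
      rw [this, Finset.card_erase_of_mem hv, hn, Nat.add_sub_cancel]
    have h1 : G.Sep (A.erase v) B (S.erase v) := ih _ _ _ hs' hn'
    have hpv : v ∉ H.parents v := by
      rw [DAG.mem_parents]
      exact fun h => h.ne rfl
    have hpa : H.parents v ⊆ A.erase v ∪ S.erase v := by
      intro x hx
      have := hfam x (.inr (DAG.mem_parents.1 hx))
      grind
    have h2 : G.Sep {v} ((A ∪ B ∪ S).erase v \ H.parents v) (H.parents v) := by
      refine DAG.sep_of_forall hpv fun b hb => ?_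
      simp only [Finset.mem_sdiff, Finset.mem_erase, DAG.mem_parents] at hb
      exact hloc b v (lt_of_le_of_ne (hmax b hb.1.2) (hf.ne hb.1.1)) hb.2
    have h3 : G.Sep {v} B (S.erase v ∪ A.erase v) := by
      have h := h2.weak_union (C := (A.erase v ∪ S.erase v) \ H.parents v) (by grind)
      have e : H.parents v ∪ (A.erase v ∪ S.erase v) \ H.parents v = S.erase v ∪ A.erase v := by
        grind
      rw [e] at h
      refine h.mono subset_rfl fun x hx => ?_
      have := hs'.disjoint x
      have := hs'.right x
      grind
    have h4 : G.Sep B (A.erase v ∪ {v}) (S.erase v) := h1.symm.contraction h3.symm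
    rcases hfam v (.inl rfl) with hvA | hvS
    · have hvS := hs.left v hvA
      rw [Finset.erase_eq_of_notMem hvS] at h4
      exact h4.symm.mono (by grind) subset_rfl
    · have h5 := h4.weak_union (C := {v}) (by simp)
      have e : S.erase v ∪ {v} = S := by grind
      rw [e] at h5
      refine h5.symm.mono (fun x hx => ?_) subset_rfl
      have := hs.left x hx
      grind

theorem DAG.split_singleton {K : DAG p} {v : Fin p} {P S : Finset (Fin p)} (hv : v ∉ P)
    (hP : ∀ x y, K.Arrow x y → y ∈ P → x ∈ P) (hS : S ⊆ P) (hpa : K.parents v ⊆ S) :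
    K.Split {v} (P \ S) S := by
  refine ⟨by grind, by grind, by grind, fun u hu => ?_⟩
  by_cases huv : u = v
  · left
    rintro x (rfl | hx)
    · simp [huv]
    · exact .inr (hpa (DAG.mem_parents.2 (huv ▸ hx)))
  · right
    have huP : u ∈ P := by grind
    rintro x (rfl | hx)
    · grind
    · have := hP x u hx huP
      grind

theorem mem_CIof_of_split {G : DAG p} {A B S : Finset (Fin p)} (h : G.Split A B S) {a b : Fin p}
    (ha : a ∈ A) (hb : b ∈ B) : (a, b, S) ∈ CIof G :=
  mem_CIof_iff.2 ⟨A, B, by simpa using ha, by simpa using hb, h⟩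

theorem mem_CIof_symm {G : DAG p} {a b : Fin p} {S : Finset (Fin p)} (h : (a, b, S) ∈ CIof G) :
    (b, a, S) ∈ CIof G :=
  mem_CIof_iff.2 (mem_CIof_iff.1 h).symm

theorem DAG.Arrow.not_mem_CIof {G : DAG p} {a b : Fin p} (h : G.Arrow a b) (S : Finset (Fin p)) :
    (a, b, S) ∉ CIof G := by
  intro hs
  obtain ⟨A, B, hA, hB, hs⟩ := mem_CIof_iff.1 hs
  simp only [Finset.singleton_subset_iff] at hA hB
  have h1 := hs.disjoint a hA
  have h2 := hs.left a hA
  have h3 := hs.right b hB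
  have h4 : b ∉ A := fun h => hs.disjoint b h hB
  rcases hs.family b (by tauto) with hf | hf
  · have := hf b (.inl rfl)
    tauto
  · have := hf a (.inr h)
    tauto

theorem CIof_anti {K K' : DAG p} (h : K.arrows ⊆ K'.arrows) : CIof K' ⊆ CIof K := by
  refine CIof_subset_of_split fun A B S hs => ⟨A, B, subset_rfl, subset_rfl, hs.disjoint, hs.left,
    hs.right, fun v hv => ?_⟩
  exact (hs.family v hv).imp (fun hf x hx => hf x (hx.imp_right fun hx => h hx))
    fun hf x hx => hf x (hx.imp_right fun hx => h hx)

/-- `K'` arises from `K` by reversing a covered arrow. -/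
def CoveredReversal (K K' : DAG p) : Prop :=
  ∃ a b, K.Covered a b ∧ ∀ x y, K'.Arrow x y ↔ (x = b ∧ y = a) ∨ (K.Arrow x y ∧ ¬ (x = a ∧ y = b))

theorem DAG.covered_iff {K : DAG p} {a b : Fin p} :
    K.Covered a b ↔ K.Arrow a b ∧ ∀ x, K.Arrow x a ↔ x ≠ a ∧ K.Arrow x b := by
  simp [DAG.Covered, Finset.ext_iff, DAG.mem_parents]

theorem CoveredReversal.symm {K K' : DAG p} (h : CoveredReversal K K') : CoveredReversal K' K := by
  obtain ⟨a, b, hab, h⟩ := h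
  rw [DAG.covered_iff] at hab
  have hne := hab.1.ne
  have hba := hab.1.asymm
  have hloop : ∀ x, ¬ K.Arrow x x := fun x h => h.ne rfl
  refine ⟨b, a, DAG.covered_iff.2 ⟨(h b a).2 (.inl ⟨rfl, rfl⟩), fun x => ?_⟩, fun x y => ?_⟩
  · have := hab.2 x
    have := hloop a
    have := hloop b
    simp only [h]
    grind
  · simp only [h]
    grind

theorem CoveredReversal.split_sep {K K' : DAG p} (h : CoveredReversal K K')
    {A B S : Finset (Fin p)} (hs : K.Split A B S) : K'.Sep A B S := by
  obtain ⟨a, b, hab, h⟩ := h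
  rw [DAG.covered_iff] at hab
  obtain ⟨hab, hcov⟩ := hab
  have hvar : ∀ v, v ≠ a → v ≠ b → ∀ x, K'.Arrow x v → K.Arrow x v := by
    intro v hva hvb x
    rw [h]
    grind
  have hva : ∀ x, K'.Arrow x a → x = b ∨ K.Arrow x a := by
    intro x
    rw [h]
    grind
  have hvb : ∀ x, K'.Arrow x b → K.Arrow x a := by
    intro x
    rw [h, hcov]
    have := hab.ne
    grind
  by_cases hb : b ∈ A ∨ b ∈ B ∨ b ∈ S
  · refine ⟨A, B, subset_rfl, subset_rfl, hs.disjoint, hs.left, hs.right, fun v hv => ?_⟩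
    have hsub : ∀ w, (∀ x, x = v ∨ K'.Arrow x v → x = w ∨ K.Arrow x w) →
        (w ∈ A ∨ w ∈ B ∨ w ∈ S) → (∀ x, x = v ∨ K'.Arrow x v → x ∈ A ∨ x ∈ S) ∨
          (∀ x, x = v ∨ K'.Arrow x v → x ∈ B ∨ x ∈ S) := fun w hw hwU =>
      (hs.family w hwU).imp (fun hf x hx => hf x (hw x hx)) fun hf x hx => hf x (hw x hx)
    by_cases hv1 : v = a ∨ v = b
    · refine hsub b (fun x hx => ?_) hb
      have := hva x
      have := hvb x
      have := hcov x
      grind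
    · exact hsub v (fun x hx => hx.imp_right (hvar v (by tauto) (by tauto) x)) hv
  by_cases ha : a ∈ A ∨ a ∈ B ∨ a ∈ S
  swap
  · refine ⟨A, B, subset_rfl, subset_rfl, hs.disjoint, hs.left, hs.right, fun v hv => ?_⟩
    have hva : v ≠ a := fun e => ha (e ▸ hv)
    have hvb : v ≠ b := fun e => hb (e ▸ hv)
    exact (hs.family v hv).imp (fun hf x hx => hf x (hx.imp_right (hvar v hva hvb x)))
      fun hf x hx => hf x (hx.imp_right (hvar v hva hvb x))
  wlog hfam : ∀ x, x = a ∨ K.Arrow x a → x ∈ A ∨ x ∈ S generalizing A B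
  · exact (this hs.symm (by tauto) (by tauto) ((hs.family a ha).resolve_left hfam)).symm
  refine ⟨insert b A, B, by simp, subset_rfl, ?_, ?_, hs.right, fun v hv => ?_⟩
  · intro x hx
    have := hs.disjoint x
    grind
  · intro x hx
    have := hs.left x
    grind
  · by_cases hv1 : v = a ∨ v = b
    · left
      intro x hx
      have := hva x
      have := hvb x
      have := hfam x
      grind
    · have hvU : v ∈ A ∨ v ∈ B ∨ v ∈ S := by grind
      have hvar' := hvar v (by tauto) (by tauto)
      refine (hs.family v hvU).imp (fun hf x hx => ?_)
        fun hf x hx => hf x (hx.imp_right (hvar' x))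
      have := hf x (hx.imp_right (hvar' x))
      grind

theorem CoveredReversal.CIof_eq {K K' : DAG p} (h : CoveredReversal K K') : CIof K = CIof K' :=
  (CIof_subset_of_split fun _ _ _ => h.split_sep).antisymm
    (CIof_subset_of_split fun _ _ _ => h.symm.split_sep)

theorem CIof_eq_of_reversals {K K' : DAG p} (h : Relation.ReflTransGen CoveredReversal K K') :
    CIof K = CIof K' := by
  induction h with
  | refl => rfl
  | tail _ h ih => exact ih.trans h.CIof_eq

theorem mkDAG_arrow {R : Fin p → Fin p → Prop} {f : Fin p → ℕ} {hf : ∀ a b, R a b → f a < f b}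
    {a b : Fin p} : (mkDAG R f hf).Arrow a b ↔ R a b := by
  simp [mkDAG, DAG.Arrow]

theorem minimalIMAP_arrow {C : Set (CIRel p)} {π : Equiv.Perm (Fin p)} {a b : Fin p} :
    (minimalIMAP C π).Arrow a b ↔ π.symm a < π.symm b ∧ (a, b, condSet π a b) ∉ C :=
  mkDAG_arrow

theorem condSet_eq {π : Equiv.Perm (Fin p)} {a b : Fin p} :
    condSet π a b = (Finset.univ.filter fun k => π.symm k < π.symm b).erase a := by
  ext k
  simp only [condSet, Finset.mem_erase, Finset.mem_filter, Finset.mem_univ, true_and]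
  have : π.symm k < π.symm b ↔ k ≠ b ∧ π.symm k ≤ π.symm b := by
    rw [lt_iff_le_and_ne, ne_eq, ne_eq, π.symm.injective.eq_iff, and_comm]
  tauto

/-- A minimal I-MAP of `G` is an independence map of `G`. -/
theorem CIof_minimalIMAP_subset (G : DAG p) (π : Equiv.Perm (Fin p)) :
    CIof (minimalIMAP (CIof G) π) ⊆ CIof G := by
  refine CIof_subset_of_local (f := fun v => (π.symm v : ℕ))
    (Fin.val_injective.comp π.symm.injective) (fun a b h => (minimalIMAP_arrow.1 h).1) ?_
  intro a v hav hna
  let P : Finset (Fin p) := Finset.univ.filter fun k => π.symm k < π.symm v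
  let N : Finset (Fin p) := P.filter fun n => ¬ (minimalIMAP (CIof G) π).Arrow n v
  have hpa : P \ N = (minimalIMAP (CIof G) π).parents v := by
    ext x
    have := fun h : (minimalIMAP (CIof G) π).Arrow x v => (minimalIMAP_arrow.1 h).1
    simp only [P, N, Finset.mem_sdiff, Finset.mem_filter, Finset.mem_univ, true_and,
      DAG.mem_parents]
    tauto
  have h := DAG.sep_of_pairwise (G := G) (v := v) (P := P) (N := N) (by simp [P]) fun n hn => by
    simp only [N, P, Finset.mem_filter, Finset.mem_univ, true_and, minimalIMAP_arrow, not_and,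
      not_not, condSet_eq] at hn
    exact hn.2 hn.1
  rw [hpa] at h
  exact mem_CIof_symm (mem_CIof_iff.2 (h.mono subset_rfl (by simpa [N, P] using ⟨hav, hna⟩)))

/-- Minimality of `minimalIMAP`. -/
theorem minimalIMAP_subset {K G : DAG p} {π : Equiv.Perm (Fin p)} (hπ : IsLinExt K π)
    (hK : CIof K ⊆ CIof G) : (minimalIMAP (CIof G) π).arrows ⊆ K.arrows := by
  rintro ⟨a, b⟩ hab
  obtain ⟨hlt, hmem⟩ := minimalIMAP_arrow.1 (show (minimalIMAP (CIof G) π).Arrow a b from hab)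
  by_contra hn
  refine hmem (hK ?_)
  rw [condSet_eq]
  have hs := DAG.split_singleton (K := K) (v := b)
    (P := Finset.univ.filter fun k => π.symm k < π.symm b)
    (S := (Finset.univ.filter fun k => π.symm k < π.symm b).erase a) (by simp)
    (fun x y hxy hy => by simpa using (hπ x y hxy).trans (by simpa using hy))
    (Finset.erase_subset _ _) (fun x hx => by
      have hx := DAG.mem_parents.1 hx
      simp only [Finset.mem_erase, Finset.mem_filter, Finset.mem_univ, true_and]
      exact ⟨fun e => hn (e ▸ hx), hπ x b hx⟩)
  exact mem_CIof_symm (mem_CIof_of_split hs (by simp) (by simpa using hlt))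

/-- A numbering of the nodes along which all arrows increase. -/
theorem DAG.exists_rank (G : DAG p) : ∃ g : Fin p → ℕ, ∀ a b, G.Arrow a b → g a < g b := by
  refine ⟨fun x => (Finset.univ.filter fun y => Relation.TransGen G.Arrow y x).card,
    fun a b hab => Finset.card_lt_card (Finset.ssubset_iff_of_subset ?_ |>.2 ⟨a, ?_, ?_⟩)⟩
  · intro y hy
    simp only [Finset.mem_filter, Finset.mem_univ, true_and] at hy ⊢
    exact hy.tail hab
  · simpa using Relation.TransGen.single hab
  · rw [Finset.mem_filter]
    exact fun h => G.acyclic a h.2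

theorem DAG.Desc.rank_le {G : DAG p} {g : Fin p → ℕ} (hg : ∀ a b, G.Arrow a b → g a < g b)
    {a b : Fin p} (h : G.Desc a b) : g a ≤ g b := by
  induction h with
  | refl => rfl
  | tail _ h ih => exact ih.trans (hg _ _ h).le

theorem DAG.Desc.mem_of_ancestral {G : DAG p} {W : Fin p → Prop}
    (hW : ∀ u v, G.Arrow u v → W v → W u) {a b : Fin p} (h : G.Desc a b) (hb : W b) : W a := by
  induction h using Relation.ReflTransGen.head_induction_on with
  | refl => exact hb
  | head h _ ih => exact hW _ _ h ih

theorem exists_isLinExt (G : DAG p) : ∃ π : Equiv.Perm (Fin p), IsLinExt G π := by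
  obtain ⟨g, hg⟩ := G.exists_rank
  refine ⟨Tuple.sort g, fun a b hab => ?_⟩
  by_contra hle
  have := Tuple.monotone_sort g (not_lt.1 hle)
  simp only [Function.comp_apply, Equiv.apply_symm_apply] at this
  exact this.not_gt (hg a b hab)

/-- No DAG covered-arrow equivalent to `H` has a proper subgraph that is an independence map
of `G`. -/
def Stable (G H : DAG p) : Prop :=
  ∀ K, Relation.ReflTransGen CoveredReversal H K →
    ∀ K' : DAG p, K'.arrows ⊆ K.arrows → CIof K' ⊆ CIof G → K' = K

/-- The parents of `Y` and `Z` other than `Y`. -/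
def DAG.JointParent (G : DAG p) (Y Z u : Fin p) : Prop :=
  u ≠ Y ∧ (G.Arrow u Y ∨ G.Arrow u Z)

/-- The arrows obtained from `G` by giving `Y` and `Z` the same parents, with `Z` pointing
to `Y`. -/
def DAG.MergeArrow (G : DAG p) (Y Z u v : Fin p) : Prop :=
  (v = Z ∧ G.JointParent Y Z u) ∨ (v = Y ∧ (G.JointParent Y Z u ∨ u = Z)) ∨
    (v ≠ Y ∧ v ≠ Z ∧ G.Arrow u v)

theorem DAG.exists_merge {G : DAG p} {Y Z : Fin p} (hYZ : G.Arrow Y Z)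
    (hnp : ∀ v, G.Arrow Y v → v ≠ Z → ¬ G.Desc v Z) :
    ∃ G' K : DAG p, G.arrows ⊆ G'.arrows ∧ CoveredReversal K G' ∧
      ∀ u v, K.Arrow u v ↔ G.MergeArrow Y Z u v := by
  obtain ⟨g, hg⟩ := G.exists_rank
  obtain ⟨N, hN⟩ : ∃ N, ∀ x, g x < N :=
    ⟨Finset.univ.sup g + 1, fun x => Nat.lt_succ_of_le (Finset.le_sup (Finset.mem_univ x))⟩
  have hne := hYZ.ne
  have hZY := hYZ.asymm
  have hloop : ∀ x, ¬ G.Arrow x x := fun x h => h.ne rfl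
  have hQ : ∀ u, G.JointParent Y Z u → u ≠ Y ∧ u ≠ Z ∧ G.Desc u Z := by
    rintro u ⟨huY, hu⟩
    refine ⟨huY, ?_, ?_⟩
    · rintro rfl
      exact hu.elim hZY (hloop _)
    · exact hu.elim (fun h => (Relation.ReflTransGen.single h).tail hYZ) .single
  have hold : ∀ u v, v ≠ Y → v ≠ Z → G.Arrow u v → G.Desc v Z → u ≠ Y ∧ u ≠ Z ∧ G.Desc u Z := by
    intro u v _ hvZ huv hv
    refine ⟨?_, ?_, .head huv hv⟩
    · rintro rfl
      exact hnp v huv hvZ hv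
    · rintro rfl
      exact (hg _ _ huv).not_ge (hv.rank_le hg)
  have hrank : ∀ (y z : ℕ), N ≤ y → y < N + 2 → N ≤ z → z < N + 2 → ∀ u v,
      (u ≠ Y ∧ u ≠ Z ∧ G.Desc u Z ∧ (v = Y ∨ v = Z)) ∨ (v ≠ Y ∧ v ≠ Z ∧ G.Arrow u v) →
      (if u = Y then y else if u = Z then z else if G.Desc u Z then g u else N + 2 + g u) <
      (if v = Y then y else if v = Z then z else if G.Desc v Z then g v else N + 2 + g v) := by
    rintro y z h1 h2 h3 h4 u v (⟨huY, huZ, hu, hv⟩ | ⟨hvY, hvZ, huv⟩)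
    · have := hN u
      grind
    · have := hN u
      have := hg u v huv
      have := hold u v hvY hvZ huv
      grind
  have hG' : ∀ u v, ((v = Y ∧ G.JointParent Y Z u) ∨ (v = Z ∧ (G.JointParent Y Z u ∨ u = Y)) ∨
      (v ≠ Y ∧ v ≠ Z ∧ G.Arrow u v)) →
      (if u = Y then N else if u = Z then N + 1 else if G.Desc u Z then g u else N + 2 + g u) <
      (if v = Y then N else if v = Z then N + 1 else if G.Desc v Z then g v else N + 2 + g v) := by
    intro u v huv
    have key := hrank N (N + 1) (by omega) (by omega) (by omega) (by omega) u v
    have := hQ u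
    by_cases h : v = Z ∧ u = Y
    · simp [h.1, h.2, hne.symm]
    · apply key
      grind
  have hK : ∀ u v, G.MergeArrow Y Z u v →
      (if u = Y then N + 1 else if u = Z then N else if G.Desc u Z then g u else N + 2 + g u) <
      (if v = Y then N + 1 else if v = Z then N else if G.Desc v Z then g v else N + 2 + g v) := by
    intro u v huv
    have key := hrank (N + 1) N (by omega) (by omega) (by omega) (by omega) u v
    have := hQ u
    by_cases h : v = Y ∧ u = Z
    · simp [h.1, h.2, hne.symm]
    · apply key
      simp only [DAG.MergeArrow] at huv
      grind
  refine ⟨mkDAG _ _ hG', mkDAG _ _ hK, ?_, ?_, fun u v => mkDAG_arrow⟩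
  · rintro ⟨u, v⟩ huv
    replace huv : G.Arrow u v := huv
    refine (mkDAG_arrow (hf := hG')).2 ?_
    have := huv.ne
    simp only [DAG.JointParent]
    grind
  · refine ⟨Z, Y, DAG.covered_iff.2 ⟨mkDAG_arrow.2 (.inr (.inl ⟨rfl, .inr rfl⟩)), fun x => ?_⟩,
      fun x y => ?_⟩
    · have := hQ x
      simp only [mkDAG_arrow, DAG.MergeArrow, hne, hne.symm]
      tauto
    · have := hQ x
      simp only [mkDAG_arrow, DAG.MergeArrow]
      rcases eq_or_ne y Y with rfl | hyY
      · simp only [hne, true_and, false_and, not_true_eq_false, ne_eq, and_true, or_false, and_false]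
        tauto
      rcases eq_or_ne y Z with rfl | hyZ
      · simp only [hyY, true_and, false_and, not_true_eq_false, ne_eq, and_true, or_false,
          false_or, and_false, not_false_eq_true]
        tauto
      · simp [hyY, hyZ]

theorem DAG.Split.of_merge {G K : DAG p} {Y Z : Fin p} (hYZ : G.Arrow Y Z)
    (hK : ∀ u v, K.Arrow u v ↔ G.MergeArrow Y Z u v) {A B S : Finset (Fin p)}
    (h : G.Split A B S) (hS : Y ∉ S) (hU : Y ∈ A ∨ Y ∈ B ∨ Y ∈ S → Z ∈ A ∨ Z ∈ B ∨ Z ∈ S) :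
    K.Split A B S := by
  refine ⟨h.disjoint, h.left, h.right, fun v hv => ?_⟩
  simp only [hK, DAG.MergeArrow, DAG.JointParent]
  by_cases hvYZ : v = Y ∨ v = Z
  · have hZ : Z ∈ A ∨ Z ∈ B ∨ Z ∈ S := hvYZ.elim (fun e => hU (e ▸ hv)) fun e => e ▸ hv
    have h1 := h.family Z hZ
    have h2 := h.family Y (h.mem_of_arrow hYZ hZ)
    have := h.disjoint Y
    have := h1.imp (fun h => h Y (.inr hYZ)) fun h => h Y (.inr hYZ)
    have := h2.imp (fun h => h Y (.inl rfl)) fun h => h Y (.inl rfl)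
    grind
  · have := h.family v hv
    grind

theorem DAG.Split.restrict {G : DAG p} {A B S T : Finset (Fin p)} (h : G.Split A B S)
    (hT : ∀ x y, G.Arrow x y → y ∈ T → x ∈ T) (hS : S ⊆ T) : G.Split (A ∩ T) (B ∩ T) S := by
  refine ⟨fun x hx => ?_, fun x hx => ?_, fun x hx => ?_, fun v hv => ?_⟩
  · have := h.disjoint x
    grind
  · have := h.left x
    grind
  · have := h.right x
    grind
  · have hvT : v ∈ T := by grind
    refine (h.family v (by grind)).imp (fun h x hx => ?_) fun h x hx => ?_
    all_goals
      have := h x hx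
      have := hT x v
      grind

/-- The ordered local Markov property. -/
theorem DAG.local_mem_CIof {H : DAG p} {f : Fin p → ℕ} (hH : ∀ a b, H.Arrow a b → f a < f b)
    {a v : Fin p} (hav : f a < f v) (hna : ¬ H.Arrow a v) : (a, v, H.parents v) ∈ CIof H :=
  mem_CIof_symm (mem_CIof_of_split (DAG.split_singleton
    (P := Finset.univ.filter fun u => f u < f v) (by simp)
    (fun x y hxy hy => by simpa using (hH x y hxy).trans (by simpa using hy))
    (fun x hx => by simpa using hH x v (DAG.mem_parents.1 hx)) subset_rfl) (by simp)
    (by simpa [DAG.mem_parents] using ⟨hav, hna⟩))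

/-- Merging `Y` with a suitable child `Z` preserves that `H` is an independence map. -/
theorem CIof_subset_of_merge {G H K : DAG p} {f : Fin p → ℕ} (hf : f.Injective)
    (hH : ∀ a b, H.Arrow a b → f a < f b) (hHG : CIof H ⊆ CIof G) {Y Z D : Fin p}
    (hW : ∀ u v, G.Arrow u v → f v < f Y + 1 → f u < f Y + 1)
    (hYZ : G.Arrow Y Z) (hZD : G.Desc Z D) (hDY : f D < f Y + 1)
    (hD : ∀ d, d ≠ Y → G.Desc Y d → f D ≤ f d)
    (hK : ∀ u v, K.Arrow u v ↔ G.MergeArrow Y Z u v)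
    (hWK : ∀ u v, K.Arrow u v → f v < f Y + 1 → f u < f Y + 1)
    (hKH : ∀ v, f Y + 1 ≤ f v → ∀ u, K.Arrow u v ↔ H.Arrow u v) : CIof H ⊆ CIof K := by
  refine CIof_subset_of_local hf hH fun a v hav hna => ?_
  rcases lt_trichotomy (f v) (f Y) with hv | hv | hv
  · have hpv : v ∉ H.parents v := by
      rw [DAG.mem_parents]
      exact fun h => h.ne rfl
    obtain ⟨A, B, hA, hB, hs⟩ := DAG.sep_of_forall (G := G) (a := v)
      (B := (Finset.univ.filter fun u => f u < f v) \ H.parents v) hpv fun b hb => by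
        simp only [Finset.mem_sdiff, Finset.mem_filter, Finset.mem_univ, true_and,
          DAG.mem_parents] at hb
        exact hHG (DAG.local_mem_CIof hH hb.1 hb.2)
    let T : Finset (Fin p) := Finset.univ.filter fun x => ∃ w, f w ≤ f v ∧ G.Desc x w
    have hT : ∀ x, x ∈ T ↔ ∃ w, f w ≤ f v ∧ G.Desc x w := by simp [T]
    have hs' := hs.restrict (T := T)
      (fun x y hxy hy => by
        obtain ⟨w, hw, hyw⟩ := (hT y).1 hy
        exact (hT x).2 ⟨w, hw, .head hxy hyw⟩)
      (fun x hx => (hT x).2 ⟨x, (hH x v (DAG.mem_parents.1 hx)).le, .refl⟩)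
    refine mem_CIof_symm (mem_CIof_of_split (hs'.of_merge hYZ hK ?_ ?_) (a := v) (b := a) ?_ ?_)
    · rw [DAG.mem_parents]
      exact fun h => (hH Y v h).not_ge hv.le
    · intro hY
      have hYT : Y ∈ T := by
        rcases hY with hY | hY | hY
        · exact (Finset.mem_inter.1 hY).2
        · exact (Finset.mem_inter.1 hY).2
        · exact (hT Y).2 ⟨Y, (hH Y v (DAG.mem_parents.1 hY)).le, .refl⟩
      obtain ⟨w, hw, hYw⟩ := (hT Y).1 hYT
      have hDv : f D ≤ f v := (hD w (by rintro rfl; omega) hYw).trans hw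
      refine hs'.mem_of_desc hZD ?_
      have hDT : D ∈ T := (hT D).2 ⟨D, hDv, .refl⟩
      by_cases hDe : D = v
      · subst hDe
        exact .inl (Finset.mem_inter.2 ⟨hA (by simp), hDT⟩)
      · have hDlt : f D < f v := lt_of_le_of_ne hDv (hf.ne hDe)
        by_cases hDp : D ∈ H.parents v
        · exact .inr (.inr hDp)
        · exact .inr (.inl (Finset.mem_inter.2 ⟨hB (by simpa [hDlt] using hDp), hDT⟩))
    · exact Finset.mem_inter.2 ⟨hA (by simp), (hT v).2 ⟨v, le_rfl, .refl⟩⟩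
    · exact Finset.mem_inter.2 ⟨hB (by simpa [DAG.mem_parents] using ⟨hav, hna⟩),
        (hT a).2 ⟨a, hav.le, .refl⟩⟩
  · obtain rfl := hf hv
    obtain ⟨A, B, hA, hB, hs⟩ := mem_CIof_iff.1 (hHG (DAG.local_mem_CIof hH hav hna))
    refine mem_CIof_of_split (hs.of_merge hYZ hK (hs.right v (by simpa using hB)) fun _ => ?_)
      (by simpa using hA) (by simpa using hB)
    refine .inr (.inr (DAG.mem_parents.2 ?_))
    by_contra hZ
    have hZlt : f Z < f v + 1 := hZD.mem_of_ancestral (W := fun x => f x < f v + 1) hW hDY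
    have hZlt' : f Z < f v := lt_of_le_of_ne (by omega) (hf.ne hYZ.ne.symm)
    exact hYZ.not_mem_CIof _ (mem_CIof_symm (hHG (DAG.local_mem_CIof hH hZlt' hZ)))
  · refine mem_CIof_symm (mem_CIof_of_split (DAG.split_singleton
      (v := v)
      (P := Finset.univ.filter fun u => f u < f v) (by simp) ?_ ?_ ?_) (a := v) (b := a) ?_ ?_)
    · intro x y hxy hy
      simp only [Finset.mem_filter, Finset.mem_univ, true_and] at hy ⊢
      by_cases hyY : f Y + 1 ≤ f y
      · exact (hH x y ((hKH y hyY x).1 hxy)).trans hy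
      · have := hWK x y hxy (by omega)
        omega
    · exact fun x hx => by simpa using hH x v (DAG.mem_parents.1 hx)
    · exact fun x hx => DAG.mem_parents.2 ((hKH v hv x).1 (DAG.mem_parents.1 hx))
    · simp
    · simpa [DAG.mem_parents] using ⟨hav, hna⟩

theorem arrow_iff_of_sink {G H : DAG p} {f : Fin p → ℕ} (hf : f.Injective)
    (hH : ∀ a b, H.Arrow a b → f a < f b) (hHG : CIof H ⊆ CIof G) {Y : Fin p}
    (hGH : ∀ v, f Y + 1 ≤ f v → ∀ u, G.Arrow u v ↔ H.Arrow u v)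
    (hW : ∀ u v, G.Arrow u v → f v < f Y + 1 → f u < f Y + 1)
    (hY : ∀ z, f z < f Y + 1 → ¬ G.Arrow Y z) (hst : Stable G H) (u : Fin p) :
    G.Arrow u Y ↔ H.Arrow u Y := by
  have hlt : ∀ u, G.Arrow u Y → f u < f Y := fun u hu => by
    have := hW u Y hu (by omega)
    have := hf.ne hu.ne
    omega
  have hWY : ∀ u v, G.Arrow u v → f v < f Y → f u < f Y := fun u v huv hv => by
    have h1 := hW u v huv (by omega)
    have h2 : u ≠ Y := by
      rintro rfl
      exact hY v (by omega) huv
    have := hf.ne h2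
    omega
  have hsub : ∀ u, G.Arrow u Y → H.Arrow u Y := by
    intro u hu
    by_contra hn
    exact hu.not_mem_CIof _ (hHG (DAG.local_mem_CIof hH (hlt u hu) hn))
  refine ⟨hsub u, fun hu => ?_⟩
  have hR : ∀ u v, (if v = Y then G.Arrow u Y else H.Arrow u v) → f u < f v := by
    intro u v h
    split_ifs at h with hv
    · exact hv ▸ hlt u h
    · exact hH u v h
  have hle : (mkDAG _ f hR).arrows ⊆ H.arrows := by
    rintro ⟨u, v⟩ huv
    replace huv := (mkDAG_arrow (hf := hR)).1 huv
    show H.Arrow u v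
    split_ifs at huv with hv
    · exact hv ▸ hsub u huv
    · exact huv
  have hCI : CIof (mkDAG _ f hR) ⊆ CIof G := by
    refine CIof_subset_of_local hf (fun a b h => hR a b (mkDAG_arrow.1 h)) fun a v hav hna => ?_
    rw [mkDAG_arrow] at hna
    split_ifs at hna with hv
    · subst hv
      have hpa : (mkDAG _ f hR).parents v = G.parents v := by
        ext x
        simp [DAG.mem_parents, mkDAG_arrow]
      rw [hpa]
      refine mem_CIof_symm (mem_CIof_of_split (DAG.split_singleton
        (P := Finset.univ.filter fun u => f u < f v) (by simp)
        (fun x y hxy hy => by simpa using hWY x y hxy (by simpa using hy))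
        (fun x hx => by simpa using hlt x (DAG.mem_parents.1 hx)) subset_rfl) (by simp)
        (by simpa [DAG.mem_parents] using ⟨hav, hna⟩))
    · have hpa : (mkDAG _ f hR).parents v = H.parents v := by
        ext x
        simp [DAG.mem_parents, mkDAG_arrow, hv]
      rw [hpa]
      exact hHG (DAG.local_mem_CIof hH hav hna)
  have heq := hst H .refl _ hle hCI
  rw [← heq, mkDAG_arrow] at hu
  simpa using hu

/-- A stable independence map of `G` is reached from `G` by covered arrow reversals. -/
theorem reversals_of_stable {H : DAG p} {f : Fin p → ℕ} (hf : f.Injective)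
    (hH : ∀ a b, H.Arrow a b → f a < f b) (k : ℕ) (G : DAG p) (hHG : CIof H ⊆ CIof G)
    (hGH : ∀ v, k ≤ f v → ∀ u, G.Arrow u v ↔ H.Arrow u v)
    (hW : ∀ u v, G.Arrow u v → f v < k → f u < k) (hst : Stable G H) :
    Relation.ReflTransGen CoveredReversal H G := by
  induction k generalizing G with
  | zero =>
    rw [DAG.ext_arrow fun u v => hGH v (Nat.zero_le _) u]
  | succ k ih =>
    by_cases hk : ∃ Y, f Y = k
    swap
    · have hlt : ∀ v, f v ≠ k := fun v hv => hk ⟨v, hv⟩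
      refine ih G hHG (fun v hv => hGH v ?_) (fun u v huv hv => ?_) hst
      · have := hlt v
        omega
      · have := hlt u
        have := hW u v huv (by omega)
        omega
    obtain ⟨Y, rfl⟩ := hk
    induction hn : (Finset.univ.filter fun z => f z < f Y + 1 ∧ G.Arrow Y z).card
      using Nat.strong_induction_on generalizing G with
    | _ n ihn =>
      subst hn
      by_cases hch : ∃ z, f z < f Y + 1 ∧ G.Arrow Y z
      swap
      · have hno : ∀ z, f z < f Y + 1 → ¬ G.Arrow Y z := fun z hz h => hch ⟨z, hz, h⟩
        refine ih G hHG (fun v hv => ?_) (fun u v huv hv => ?_) hst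
        · rcases hv.eq_or_lt with hv | hv
          · obtain rfl := hf hv
            exact arrow_iff_of_sink hf hH hHG hGH hW hno hst
          · exact hGH v hv
        · have h1 := hW u v huv (by omega)
          have h2 : u ≠ Y := by
            rintro rfl
            exact hno v (by omega) huv
          have := hf.ne h2
          omega
      obtain ⟨z, hz, hYz⟩ := hch
      obtain ⟨g, hg⟩ := G.exists_rank
      obtain ⟨D, hD, hDmin⟩ := Finset.exists_min_image
        (Finset.univ.filter fun d => d ≠ Y ∧ G.Desc Y d) f
        ⟨z, by simpa using ⟨hYz.ne.symm, Relation.ReflTransGen.single hYz⟩⟩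
      simp only [Finset.mem_filter, Finset.mem_univ, true_and, and_imp] at hD hDmin
      obtain ⟨Z, hZ, hZmin⟩ := Finset.exists_min_image
        (Finset.univ.filter fun z => G.Arrow Y z ∧ G.Desc z D) g (by
          rcases Relation.ReflTransGen.cases_head hD.2 with h | ⟨c, h1, h2⟩
          · exact absurd h.symm hD.1
          · exact ⟨c, by simpa using ⟨h1, h2⟩⟩)
      simp only [Finset.mem_filter, Finset.mem_univ, true_and, and_imp] at hZ hZmin
      obtain ⟨hYZ, hZD⟩ := hZ
      have hDY : f D < f Y + 1 := (hDmin z hYz.ne.symm (.single hYz)).trans_lt hz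
      have hZY : f Z < f Y + 1 := hZD.mem_of_ancestral (W := fun x => f x < f Y + 1) hW hDY
      obtain ⟨G', K, hGG', hKG', hK⟩ := G.exists_merge hYZ fun v hv hvZ hd => by
        have h1 := hZmin v hv (hd.trans hZD)
        rcases Relation.ReflTransGen.cases_head hd with h | ⟨c, h2, h3⟩
        · exact hvZ h
        · have := hg _ _ h2
          have := DAG.Desc.rank_le hg h3
          omega
      have hWK : ∀ u v, K.Arrow u v → f v < f Y + 1 → f u < f Y + 1 := by
        intro u v huv hv
        rw [hK, DAG.MergeArrow, DAG.JointParent] at huv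
        have h1 := hW u Y
        have h2 := hW u Z
        have h3 := hW u v
        grind
      have hKH : ∀ v, f Y + 1 ≤ f v → ∀ u, K.Arrow u v ↔ H.Arrow u v := by
        intro v hv u
        rw [hK, DAG.MergeArrow, ← hGH v hv]
        have h1 : v ≠ Y := by
          rintro rfl
          omega
        have h2 : v ≠ Z := by
          rintro rfl
          omega
        simp [h1, h2]
      have hHK : CIof H ⊆ CIof K := CIof_subset_of_merge hf hH hHG hW hYZ hZD hDY hDmin hK hWK hKH
      have hKG : CIof K ⊆ CIof G := hKG'.CIof_eq ▸ CIof_anti hGG'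
      have hlt : (Finset.univ.filter fun z => f z < f Y + 1 ∧ K.Arrow Y z).card <
          (Finset.univ.filter fun z => f z < f Y + 1 ∧ G.Arrow Y z).card := by
        have hne := hYZ.ne
        refine Finset.card_lt_card (Finset.ssubset_iff_of_subset (fun x hx => ?_) |>.2 ⟨Z, ?_, ?_⟩)
        · simp only [Finset.mem_filter, Finset.mem_univ, true_and, hK, DAG.MergeArrow,
            DAG.JointParent] at hx ⊢
          grind
        · exact Finset.mem_filter.2 ⟨Finset.mem_univ _, hZY, hYZ⟩
        · simp only [Finset.mem_filter, Finset.mem_univ, true_and, hK, DAG.MergeArrow,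
            DAG.JointParent]
          grind
      have hrev := (ihn _ hlt K hHK
        (fun K₁ h1 K₂ h2 h3 => hst K₁ h1 K₂ h2 (h3.trans hKG)) hKH hWK rfl).tail hKG'
      rwa [hst G' hrev G hGG' subset_rfl]

theorem IsLinExt.step {C : Set (CIRel p)} {σ ρ : Equiv.Perm (Fin p)} {K : DAG p}
    (hK : CoveredReversal (minimalIMAP C σ) K) (hρ : IsLinExt K ρ) :
    CoveredReversalStep C σ ρ := by
  obtain ⟨a, b, hab, h⟩ := hK
  refine ⟨a, b, hab, hρ _ _ ((h b a).2 (.inl ⟨rfl, rfl⟩)), fun x y hxy hne => ?_⟩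
  exact hρ _ _ ((h x y).2 (.inr ⟨hxy, by simpa using hne⟩))

theorem CoveredReversal.numArrows_eq {K K' : DAG p} (h : CoveredReversal K K') :
    K'.numArrows = K.numArrows := by
  obtain ⟨a, b, hab, h⟩ := h
  have hab := hab.1
  have e : K'.arrows = insert (b, a) (K.arrows.erase (a, b)) := by
    ext ⟨x, y⟩
    simpa [DAG.Arrow, and_comm] using h x y
  have hba : (b, a) ∉ K.arrows.erase (a, b) := fun h => hab.asymm (Finset.mem_of_mem_erase h)
  rw [DAG.numArrows, e, Finset.card_insert_of_notMem hba, Finset.card_erase_of_mem hab,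
    DAG.numArrows]
  exact Nat.sub_add_cancel (Finset.card_pos.2 ⟨_, hab⟩)

/-- Without escape, every DAG reached from a minimal I-MAP by covered arrow reversals is itself a
minimal I-MAP. -/
theorem exists_seq_of_reversals {G K : DAG p} {π : Equiv.Perm (Fin p)}
    (hπ : ¬ EscapesByCoveredReversals (CIof G) π)
    (h : Relation.ReflTransGen CoveredReversal (minimalIMAP (CIof G) π) K) :
    ∃ (s : List (Equiv.Perm (Fin p))) (ρ : Equiv.Perm (Fin p)), s.head? = some π ∧
      s.getLast? = some ρ ∧ WeaklyDecreasingSeq (CIof G) s ∧ minimalIMAP (CIof G) ρ = K ∧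
      K.numArrows = (minimalIMAP (CIof G) π).numArrows := by
  induction h with
  | refl => exact ⟨[π], π, rfl, rfl, List.isChain_singleton _, rfl, rfl⟩
  | @tail K K' hK hKK' ih =>
    obtain ⟨s, ρ, hs, hl, hchain, rfl, hcard⟩ := ih
    obtain ⟨ρ', hρ'⟩ := exists_isLinExt K'
    have hCI : CIof K' ⊆ CIof G :=
      CIof_eq_of_reversals (hK.tail hKK') ▸ CIof_minimalIMAP_subset G π
    have hsub := minimalIMAP_subset hρ' hCI
    have hle := Finset.card_le_card hsub
    have hcard' := hKK'.numArrows_eq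
    have hhead : (s ++ [ρ']).head? = some π := by
      cases s <;> simp_all
    have hseq : WeaklyDecreasingSeq (CIof G) (s ++ [ρ']) := by
      refine List.isChain_append.2 ⟨hchain, List.isChain_singleton _, fun x hx y hy => ?_⟩
      obtain rfl : ρ = x := by simpa [hl] using hx
      obtain rfl : ρ' = y := by simpa using hy
      exact ⟨hρ'.step hKK', hle.trans hcard'.le⟩
    refine ⟨s ++ [ρ'], ρ', hhead, by simp, hseq, ?_, hcard'.trans hcard⟩
    have hge : ¬ (minimalIMAP (CIof G) ρ').numArrows < (minimalIMAP (CIof G) π).numArrows :=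
      fun hlt => hπ ⟨_, ρ', hhead, by simp, hseq, hlt⟩
    have := Finset.eq_of_subset_of_card_le hsub (by
      simp only [DAG.numArrows] at *
      omega)
    exact DAG.ext_arrow fun a b => by rw [DAG.Arrow, DAG.Arrow, this]

theorem isLinExt_minimalIMAP (C : Set (CIRel p)) (π : Equiv.Perm (Fin p)) :
    IsLinExt (minimalIMAP C π) π :=
  fun _ _ h => (minimalIMAP_arrow.1 h).1

theorem stable_minimalIMAP {G : DAG p} {π : Equiv.Perm (Fin p)}
    (hπ : ¬ EscapesByCoveredReversals (CIof G) π) : Stable G (minimalIMAP (CIof G) π) := by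
  intro K hK K' hsub hCI
  obtain ⟨s, ρ, -, -, -, rfl, -⟩ := exists_seq_of_reversals hπ hK
  have := minimalIMAP_subset (fun a b h => isLinExt_minimalIMAP _ ρ a b (hsub h)) hCI
  have := hsub.antisymm this
  exact DAG.ext_arrow fun a b => by rw [DAG.Arrow, DAG.Arrow, this]

end GSP

namespace GSP

/-- Corollary 12: pointwise consistency of the triangle
(greedy) SP algorithm under faithfulness. If `C = CI(G*)` is exactly the set
of d-separation statements of a DAG `G*`, then `C` satisfies the TSP
assumption with respect to `G*`: every minimal I-MAP `G_π` from which no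
weakly decreasing sequence of covered arrow reversals reaches a minimal I-MAP
with strictly fewer arrows is Markov equivalent to `G*`. -/
theorem greedySP_pointwise_consistent_under_faithfulness
    (p : ℕ) (Gstar : DAG p) :
    TSP (CIof Gstar) Gstar := by
  refine ⟨subset_rfl, fun π hπ => CIof_eq_of_reversals ?_⟩
  exact reversals_of_stable (f := fun v => (π.symm v : ℕ))
    (Fin.val_injective.comp π.symm.injective) (fun a b h => isLinExt_minimalIMAP _ π a b h) p Gstar
    (CIof_minimalIMAP_subset Gstar π) (fun v hv => absurd hv (by simp))
    (fun u _ _ _ => (π.symm u).isLt) (stable_minimalIMAP hπ)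

end GSP
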